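/- (Lemma 5: Lemma on killing.) Let σ > 0 and let η satisfy 0 < η < h(0). Let θ̄₁ ∈ (0,1) be the unique solution of (1 − θ̄₁)·h(θ̄₁) = η (equivalently, of T(θ) = 1 where T(θ) = θ + η/h(θ), which is strictly increasing and continuous). Then there exists κ_c ∈ (0,1) such that for every κ ∈ (0, κ_c], setting λ_κ = (κ^{−1} − 1)/η, one has for all θ ∈ [0, θ̄₁]: g(θ) + (log κ^{−1})/λ_κ < g( θ + (κ^{−1} − 1)/(λ_κ·h(θ)) ), i.e. g(θ) + η·(log κ^{−1})/(κ^{−1} − 1) < g(θ + η/h(θ)). -/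

import Mathlib

/-- The standard normal cumulative distribution function
`Φ(x) = (1/√(2π)) ∫_{-∞}^x e^{-u²/2} du`. -/
noncomputable def Phi (x : ℝ) : ℝ :=
  (Real.sqrt (2 * Real.pi))⁻¹ * ∫ u in Set.Iic x, Real.exp (-u ^ 2 / 2)

/-- The discount function `h(t) = 2Φ(σ(1-t)/2) - 1` for volatility `σ`. -/
noncomputable def h (σ t : ℝ) : ℝ := 2 * Phi (σ * (1 - t) / 2) - 1

/-- `g(t) = ∫₀ᵗ h(u) du`. -/
noncomputable def g (σ t : ℝ) : ℝ := ∫ u in (0:ℝ)..t, h σ u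

/-- The explicit derivative of `h`: `h′(t) = -(σ/√(2π))·exp(-σ²(1-t)²/8)`. -/
noncomputable def hDeriv (σ t : ℝ) : ℝ :=
  -(σ / Real.sqrt (2 * Real.pi)) * Real.exp (-(σ ^ 2 * (1 - t) ^ 2) / 8)

lemma phi_cont : Continuous (fun u : ℝ => Real.exp (-u ^ 2 / 2)) := by fun_prop

lemma phi_integrable : MeasureTheory.Integrable (fun u : ℝ => Real.exp (-u ^ 2 / 2)) := by
  have := integrable_exp_neg_mul_sq (b := 1/2) (by norm_num)
  refine this.congr (Filter.Eventually.of_forall fun u => ?_)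
  simp only []
  congr 1; ring

lemma Phi_sub (a b : ℝ) : Phi b - Phi a =
    (Real.sqrt (2 * Real.pi))⁻¹ * ∫ u in a..b, Real.exp (-u ^ 2 / 2) := by
  unfold Phi
  rw [← mul_sub, intervalIntegral.integral_Iic_sub_Iic phi_integrable.integrableOn
    phi_integrable.integrableOn]

lemma Phi_zero : Phi 0 = 1 / 2 := by
  unfold Phi
  have h1 := integral_gaussian_Ioi (1/2)
  have h2 := integral_comp_neg_Iic (0:ℝ) (fun u : ℝ => Real.exp (-(1/2) * u ^ 2))
  have h3 : (∫ u in Set.Iic (0:ℝ), Real.exp (-u ^ 2 / 2)) = Real.sqrt (2 * Real.pi) / 2 := by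
    rw [neg_zero, h1] at h2
    rw [show 2 * Real.pi = Real.pi / (1/2) by ring, ← h2]
    congr 1; ext u; congr 1; ring
  rw [h3]
  have : Real.sqrt (2 * Real.pi) ≠ 0 := by positivity
  field_simp

lemma Phi_strictMono : StrictMono Phi := by
  intro a b hab
  have := Phi_sub a b
  have h2 : 0 < ∫ u in a..b, Real.exp (-u ^ 2 / 2) :=
    intervalIntegral.intervalIntegral_pos_of_pos (phi_cont.intervalIntegrable _ _)
      (fun x => Real.exp_pos _) hab
  have h3 : 0 < (Real.sqrt (2 * Real.pi))⁻¹ * ∫ u in a..b, Real.exp (-u ^ 2 / 2) := by positivity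
  linarith

lemma h_strictAnti (σ : ℝ) (hσ : 0 < σ) : StrictAnti (h σ) := by
  intro a b hab
  have : Phi (σ * (1 - b) / 2) < Phi (σ * (1 - a) / 2) := Phi_strictMono (by nlinarith)
  unfold h
  linarith

lemma h_one (σ : ℝ) : h σ 1 = 0 := by
  simp [h, Phi_zero]

lemma g_lower (σ a b : ℝ) (hσ : 0 < σ) (hab : a ≤ b) (hb : b ≤ 1) :
    g σ a + (b - a) / 2 * h σ ((a + b) / 2) ≤ g σ b := by
  have hI : ∀ x y, IntervalIntegrable (h σ) MeasureTheory.volume x y := fun x y =>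
    (h_strictAnti σ hσ).antitone.intervalIntegrable
  have e1 : g σ a + (∫ u in a..(a+b)/2, h σ u) = g σ ((a+b)/2) :=
    intervalIntegral.integral_add_adjacent_intervals (hI _ _) (hI _ _)
  have e2 : g σ ((a+b)/2) + (∫ u in (a+b)/2..b, h σ u) = g σ b :=
    intervalIntegral.integral_add_adjacent_intervals (hI _ _) (hI _ _)
  have e3 : 0 ≤ ∫ u in (a+b)/2..b, h σ u := by
    refine intervalIntegral.integral_nonneg (by linarith) fun u hu => ?_
    rw [← h_one σ]
    exact (h_strictAnti σ hσ).antitone (by linarith [hu.2])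
  have e4 : (∫ u in a..(a+b)/2, h σ ((a + b) / 2)) ≤ ∫ u in a..(a+b)/2, h σ u := by
    refine intervalIntegral.integral_mono_on (by linarith) (by simp) (hI _ _) fun u hu => ?_
    exact (h_strictAnti σ hσ).antitone hu.2
  rw [intervalIntegral.integral_const, smul_eq_mul] at e4
  have : (a+b)/2 - a = (b-a)/2 := by ring
  rw [this] at e4
  linarith

/-- Lemma 5 (Lemma on killing): given `0 < η < h(0)` and `θ̄₁ ∈ (0,1)` with
`(1-θ̄₁)h(θ̄₁) = η`, there is a critical `κ_c ∈ (0,1)` such that for every `κ ∈ (0,κ_c]`,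
setting `λ_κ = (κ⁻¹-1)/η`, the killing inequality holds for all `θ ∈ [0,θ̄₁]`. -/
theorem stmt_16 (σ η θbar1 : ℝ) (hσ : 0 < σ) (hη : 0 < η) (hηlt : η < h σ 0)
    (hθ : θbar1 ∈ Set.Ioo (0:ℝ) 1) (hθeq : (1 - θbar1) * h σ θbar1 = η) :
    ∃ κc ∈ Set.Ioo (0:ℝ) 1, ∀ κ ∈ Set.Ioc (0:ℝ) κc, ∀ θ ∈ Set.Icc (0:ℝ) θbar1,
      g σ θ + Real.log κ⁻¹ / ((κ⁻¹ - 1) / η)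
        < g σ (θ + (κ⁻¹ - 1) / (((κ⁻¹ - 1) / η) * h σ θ)) ∧
      g σ θ + η * Real.log κ⁻¹ / (κ⁻¹ - 1) < g σ (θ + η / h σ θ) := by
  obtain ⟨hθ0, hθ1⟩ := hθ
  have hA := h_strictAnti σ hσ
  have hpos : ∀ t, t < 1 → 0 < h σ t := fun t ht => by
    rw [← h_one σ]; exact hA ht
  have h0 : 0 < h σ 0 := hpos 0 one_pos
  set M := h σ ((1 + θbar1) / 2) with hM
  have hMpos : 0 < M := hpos _ (by linarith)
  set m := η / h σ 0 / 2 * M with hm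
  have hmpos : 0 < m := by positivity
  have hev := Real.isLittleO_log_id_atTop.def (c := m / (4 * η)) (by positivity)
  obtain ⟨X, hX⟩ := Filter.eventually_atTop.1 hev
  set Y := max X 2 with hY
  have hY2 : 2 ≤ Y := le_max_right _ _
  have hYinv : Y⁻¹ ≤ 2⁻¹ := inv_anti₀ (by norm_num) hY2
  refine ⟨Y⁻¹, ⟨by positivity, by norm_num at hYinv ⊢; linarith⟩, ?_⟩
  rintro κ ⟨hκ, hκY⟩ θ ⟨ht0, ht1⟩
  have hxY : Y ≤ κ⁻¹ := (le_inv_comm₀ hκ (by positivity)).1 hκY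
  generalize κ⁻¹ = x at hxY ⊢
  have hx2 : 2 ≤ x := hY2.trans hxY
  have hlog : Real.log x ≤ m / (4 * η) * x := by
    have := hX x ((le_max_left _ _).trans hxY)
    simp only [id, Real.norm_eq_abs] at this
    rw [abs_of_pos (by linarith : 0 < x)] at this
    exact (le_abs_self _).trans this
  have hθpos : 0 < h σ θ := hpos _ (by linarith)
  have hx1 : 0 < x - 1 := by linarith
  have key : g σ θ + η * Real.log x / (x - 1) < g σ (θ + η / h σ θ) := by
    have hs : η * Real.log x / (x - 1) < m := by
      rw [div_lt_iff₀ hx1]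
      have : η * Real.log x ≤ η * (m / (4 * η) * x) := by gcongr
      have e : η * (m / (4 * η) * x) = m * x / 4 := by field_simp
      nlinarith
    have hT : θ + η / h σ θ ≤ 1 := by
      have : η / h σ θ ≤ 1 - θ := by
        rw [div_le_iff₀ hθpos, ← hθeq]
        have := hA.antitone ht1
        have := hpos _ hθ1
        apply mul_le_mul <;> linarith
      linarith
    have hd : 0 < η / h σ θ := by positivity
    have hl := g_lower σ θ (θ + η / h σ θ) hσ (by linarith) hT
    have h1 : M ≤ h σ ((θ + (θ + η / h σ θ)) / 2) := hA.antitone (by linarith)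
    have h2 : η / h σ 0 ≤ η / h σ θ := by
      have := hA.antitone ht0
      gcongr
    have h3 : m ≤ (θ + η / h σ θ - θ) / 2 * h σ ((θ + (θ + η / h σ θ)) / 2) := by
      rw [hm, add_sub_cancel_left]
      gcongr
    linarith
  refine ⟨?_, key⟩
  convert key using 2
  · field_simp
  · field_simp
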